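/- Let Ω ⊆ ℝ^N be Lebesgue measurable with |Ω| < ∞, let T > 0 and λ > 0, and write λΩ := {λx : x ∈ Ω}. Then the abscissae of convergence satisfy D(ζ_{∞,λΩ}) = D(ζ_{∞,Ω}) = dim̄_B(∞,Ω), and for all s ∈ ℂ with Re s > dim̄_B(∞,Ω) one has ζ_{∞,λΩ}(s;λT) = λ^{-s} ζ_{∞,Ω}(s;T). Furthermore, if ω is a simple pole of a meromorphic continuation of ζ_{∞,Ω} to some open connected neighborhood of the critical line {Re s = dim̄_B(∞,Ω)}, then ζ_{∞,λΩ} has the corresponding continuation with a simple pole at ω and res(ζ_{∞,λΩ}, ω) = λ^{-ω} res(ζ_{∞,Ω}, ω). -/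

import Mathlib

open MeasureTheory Filter Set Complex Topology
open scoped ENNReal Real

noncomputable section

/-- The "tail" of `Ω` beyond radius `t`: the complement of the open Euclidean ball of
radius `t` centered at `0`, intersected with `Ω`. -/
def tailSet (N : ℕ) (Ω : Set (EuclideanSpace ℝ (Fin N))) (t : ℝ) :
    Set (EuclideanSpace ℝ (Fin N)) :=
  {x | x ∈ Ω ∧ t ≤ ‖x‖}

/-- The tube function `t ↦ |_tΩ|` at infinity. -/
def tubeVol (N : ℕ) (Ω : Set (EuclideanSpace ℝ (Fin N))) (t : ℝ) : ℝ :=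
  (volume (tailSet N Ω t)).toReal

/-- Upper `r`-dimensional Minkowski content of `Ω` at infinity. -/
def upperMinkContent (N : ℕ) (Ω : Set (EuclideanSpace ℝ (Fin N))) (r : ℝ) : ℝ≥0∞ :=
  Filter.limsup (fun t : ℝ => volume (tailSet N Ω t) / ENNReal.ofReal (t ^ ((N : ℝ) + r)))
    Filter.atTop

/-- Lower `r`-dimensional Minkowski content of `Ω` at infinity. -/
def lowerMinkContent (N : ℕ) (Ω : Set (EuclideanSpace ℝ (Fin N))) (r : ℝ) : ℝ≥0∞ :=
  Filter.liminf (fun t : ℝ => volume (tailSet N Ω t) / ENNReal.ofReal (t ^ ((N : ℝ) + r)))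
    Filter.atTop

/-- Upper Minkowski dimension of `Ω` at infinity. -/
def upperMinkDim (N : ℕ) (Ω : Set (EuclideanSpace ℝ (Fin N))) : ℝ :=
  sInf {r : ℝ | upperMinkContent N Ω r = 0}

/-- Lower Minkowski dimension of `Ω` at infinity. -/
def lowerMinkDim (N : ℕ) (Ω : Set (EuclideanSpace ℝ (Fin N))) : ℝ :=
  sInf {r : ℝ | lowerMinkContent N Ω r = 0}

/-- Distance (Lapidus) zeta function of `Ω` at infinity. -/
def distZeta (N : ℕ) (Ω : Set (EuclideanSpace ℝ (Fin N))) (T : ℝ) (s : ℂ) : ℂ :=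
  ∫ x in tailSet N Ω T, (‖x‖ : ℂ) ^ (-s - (N : ℂ))

/-- Tube zeta function of `Ω` at infinity. -/
def tubeZeta (N : ℕ) (Ω : Set (EuclideanSpace ℝ (Fin N))) (T : ℝ) (s : ℂ) : ℂ :=
  ∫ t in Set.Ioi T, (t : ℂ) ^ (-s - (N : ℂ) - 1) * ((tubeVol N Ω t : ℝ) : ℂ)

/-- Abscissa of (absolute) convergence of the distance zeta function at infinity. -/
def distAbscissa (N : ℕ) (Ω : Set (EuclideanSpace ℝ (Fin N))) (T : ℝ) : ℝ :=
  sInf {σ : ℝ | ∀ s : ℂ, σ < s.re →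
    IntegrableOn (fun x => (‖x‖ : ℂ) ^ (-s - (N : ℂ))) (tailSet N Ω T) volume}

/-- Abscissa of (absolute) convergence of the tube zeta function at infinity. -/
def tubeAbscissa (N : ℕ) (Ω : Set (EuclideanSpace ℝ (Fin N))) (T : ℝ) : ℝ :=
  sInf {σ : ℝ | ∀ s : ℂ, σ < s.re →
    IntegrableOn (fun t : ℝ => (t : ℂ) ^ (-s - (N : ℂ) - 1) * ((tubeVol N Ω t : ℝ) : ℂ))
      (Set.Ioi T) volume}

/-- The mass that a finite measure puts outside a ball tends to zero as the radius grows. -/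
lemma tendsto_measure_le_norm_atTop {E : Type*} [NormedAddCommGroup E] [MeasurableSpace E]
    [OpensMeasurableSpace E] (ν : Measure E) [IsFiniteMeasure ν] :
    Tendsto (fun t : ℝ => ν {x : E | t ≤ ‖x‖}) atTop (𝓝 0) := by
  have h := tendsto_measure_iInter_atTop (μ := ν) (s := fun t : ℝ => {x : E | t ≤ ‖x‖})
    (fun t => (measurableSet_le measurable_const measurable_norm).nullMeasurableSet)
    (fun a b hab x (hx : b ≤ ‖x‖) => hab.trans hx) ⟨0, measure_ne_top _ _⟩
  have hempty : ⋂ t : ℝ, {x : E | t ≤ ‖x‖} = ∅ := by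
    ext x
    simp only [mem_iInter, mem_ofPred_eq, mem_empty_iff_false, iff_false, not_forall, not_le]
    exact ⟨‖x‖ + 1, by linarith⟩
  rwa [hempty, measure_empty] at h

section

variable {N : ℕ} {Ω : Set (EuclideanSpace ℝ (Fin N))}

lemma measurableSet_tailSet (hmeas : MeasurableSet Ω) (t : ℝ) :
    MeasurableSet (tailSet N Ω t) :=
  hmeas.inter (measurableSet_le measurable_const measurable_norm)

lemma volume_tailSet_lt_top (hfin : volume Ω < ⊤) (t : ℝ) :
    volume (tailSet N Ω t) < ⊤ :=
  (measure_mono fun _ hx => hx.1).trans_lt hfin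

lemma tailSet_smul {l : ℝ} (hl : 0 < l) (T : ℝ) :
    tailSet N ((fun x => l • x) '' Ω) (l * T) = (fun x => l • x) '' tailSet N Ω T := by
  ext y
  constructor
  · rintro ⟨⟨x, hx, rfl⟩, hy⟩
    refine ⟨x, ⟨hx, ?_⟩, rfl⟩
    simpa [norm_smul, abs_of_pos hl, hl] using hy
  · rintro ⟨x, ⟨hx, hxT⟩, rfl⟩
    refine ⟨⟨x, hx, rfl⟩, ?_⟩
    simpa [norm_smul, abs_of_pos hl, hl] using hxT

lemma tendsto_volume_tailSet_atTop (hmeas : MeasurableSet Ω) (hfin : volume Ω < ⊤) :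
    Tendsto (fun t => volume (tailSet N Ω t)) atTop (𝓝 0) := by
  have : IsFiniteMeasure (volume.restrict Ω) := ⟨by simpa using hfin⟩
  refine (tendsto_measure_le_norm_atTop (volume.restrict Ω)).congr fun t => ?_
  rw [Measure.restrict_apply' hmeas, inter_comm]
  rfl

lemma norm_cpow_norm_of_mem_tailSet {T : ℝ} (hT : 0 < T) {x : EuclideanSpace ℝ (Fin N)}
    (hx : x ∈ tailSet N Ω T) (s : ℂ) :
    ‖(‖x‖ : ℂ) ^ (-s - (N : ℂ))‖ = ‖x‖ ^ (-s.re - (N : ℝ)) := by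
  rw [norm_cpow_eq_rpow_re_of_pos (hT.trans_le hx.2)]
  simp

/-- Absolute convergence of the distance zeta integral depends on the real part of `s` only. -/
lemma integrableOn_cpow_norm_iff (hmeas : MeasurableSet Ω) {T : ℝ} (hT : 0 < T) (s : ℂ) :
    IntegrableOn (fun x => (‖x‖ : ℂ) ^ (-s - (N : ℂ))) (tailSet N Ω T) volume ↔
      IntegrableOn (fun x => ‖x‖ ^ (-s.re - (N : ℝ))) (tailSet N Ω T) volume := by
  have hm : Measurable fun x : EuclideanSpace ℝ (Fin N) => (‖x‖ : ℂ) ^ (-s - (N : ℂ)) := by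
    fun_prop
  unfold IntegrableOn
  rw [← integrable_norm_iff hm.aestronglyMeasurable]
  refine integrable_congr ?_
  filter_upwards [ae_restrict_mem (measurableSet_tailSet hmeas T)] with x hx
  exact norm_cpow_norm_of_mem_tailSet hT hx s

lemma integrableOn_rpow_norm_of_nonpos (hmeas : MeasurableSet Ω) (hfin : volume Ω < ⊤)
    {T : ℝ} (hT : 0 < T) {p : ℝ} (hp : p ≤ 0) :
    IntegrableOn (fun x => ‖x‖ ^ p) (tailSet N Ω T) volume := by
  refine Measure.integrableOn_of_bounded (M := T ^ p) (volume_tailSet_lt_top hfin T).ne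
    (measurable_norm.pow_const p).aestronglyMeasurable ?_
  filter_upwards [ae_restrict_mem (measurableSet_tailSet hmeas T)] with x hx
  rw [Real.norm_of_nonneg (by positivity)]
  exact Real.rpow_le_rpow_of_nonpos hT hx.2 hp

/-- Layer-cake criterion: a power bound on the tails gives integrability of powers of the norm. -/
lemma integrableOn_rpow_norm_of_eventually_volume_le (hmeas : MeasurableSet Ω)
    (hfin : volume Ω < ⊤) (T : ℝ) {p q : ℝ} (hp : 0 < p) (hpq : p + q < 0)
    (h : ∀ᶠ t in atTop, volume (tailSet N Ω t) ≤ ENNReal.ofReal (t ^ q)) :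
    IntegrableOn (fun x => ‖x‖ ^ p) (tailSet N Ω T) volume := by
  obtain ⟨a, ha0, ha⟩ : ∃ a : ℝ, 0 < a ∧
      ∀ t ≥ a, volume (tailSet N Ω t) ≤ ENNReal.ofReal (t ^ q) := by
    obtain ⟨a, ha⟩ := eventually_atTop.1 h
    exact ⟨max a 1, by positivity, fun t ht => ha t ((le_max_left _ _).trans ht)⟩
  set μ := volume.restrict (tailSet N Ω T) with hμ
  have hμle : ∀ t, μ {x | t ≤ ‖x‖} ≤ volume (tailSet N Ω t) := fun t => by
    rw [hμ, Measure.restrict_apply' (measurableSet_tailSet hmeas T)]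
    exact measure_mono fun x hx => ⟨hx.2.1, hx.1⟩
  refine ⟨(measurable_norm.pow_const p).aestronglyMeasurable, ?_⟩
  rw [hasFiniteIntegral_iff_ofReal (ae_of_all _ fun x => by positivity),
    lintegral_rpow_eq_lintegral_meas_le_mul μ (ae_of_all _ fun x => norm_nonneg x)
      (by fun_prop) hp]
  refine ENNReal.mul_lt_top ENNReal.ofReal_lt_top ?_
  rw [← Ioc_union_Ioi_eq_Ioi ha0.le]
  refine (lintegral_union_le _ _ _).trans_lt (ENNReal.add_lt_top.2 ⟨?_, ?_⟩)
  · have hint : IntegrableOn (fun t : ℝ => t ^ (p - 1)) (Ioc 0 a) volume :=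
      (intervalIntegrable_iff_integrableOn_Ioc_of_le ha0.le).1
        (intervalIntegral.intervalIntegrable_rpow' (by linarith))
    calc ∫⁻ t in Ioc 0 a, μ {x | t ≤ ‖x‖} * ENNReal.ofReal (t ^ (p - 1))
        ≤ ∫⁻ t in Ioc 0 a, volume Ω * ENNReal.ofReal (t ^ (p - 1)) :=
          lintegral_mono fun t =>
            mul_le_mul_left ((hμle t).trans (measure_mono fun _ hx => hx.1)) _
      _ = volume Ω * ∫⁻ t in Ioc 0 a, ENNReal.ofReal (t ^ (p - 1)) :=
          lintegral_const_mul _ (by fun_prop)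
      _ < ⊤ := ENNReal.mul_lt_top hfin hint.lintegral_lt_top
  · have hint : IntegrableOn (fun t : ℝ => t ^ (q + (p - 1))) (Ioi a) volume :=
      integrableOn_Ioi_rpow_of_lt (by linarith) ha0
    refine lt_of_le_of_lt (setLIntegral_mono' measurableSet_Ioi fun t ht => ?_)
      hint.lintegral_lt_top
    have ht0 : 0 < t := ha0.trans ht
    rw [Real.rpow_add ht0, ENNReal.ofReal_mul (by positivity)]
    exact mul_le_mul_left ((hμle t).trans (ha t (le_of_lt ht))) _

lemma integrableOn_rpow_norm_of_upperMinkContent_eq_zero (hmeas : MeasurableSet Ω)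
    (hfin : volume Ω < ⊤) {T : ℝ} (hT : 0 < T) {r σ : ℝ}
    (hr : upperMinkContent N Ω r = 0) (hσ : r < σ) :
    IntegrableOn (fun x => ‖x‖ ^ (-σ - (N : ℝ))) (tailSet N Ω T) volume := by
  rcases le_or_gt (-σ - (N : ℝ)) 0 with hp | hp
  · exact integrableOn_rpow_norm_of_nonpos hmeas hfin hT hp
  · refine integrableOn_rpow_norm_of_eventually_volume_le (q := N + r) hmeas hfin T hp
      (by linarith) ?_
    have hlt : upperMinkContent N Ω r < 1 := by simp [hr]
    filter_upwards [eventually_lt_of_limsup_lt hlt, eventually_gt_atTop 0] with t ht ht0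
    have hpos : 0 < t ^ ((N : ℝ) + r) := by positivity
    have hle := (ENNReal.div_le_iff (ENNReal.ofReal_pos.2 hpos).ne' ENNReal.ofReal_ne_top).1 ht.le
    rwa [one_mul] at hle

lemma upperMinkContent_eq_zero_of_integrableOn (hmeas : MeasurableSet Ω)
    (hfin : volume Ω < ⊤) {T r : ℝ}
    (hint : IntegrableOn (fun x => ‖x‖ ^ (-r - (N : ℝ))) (tailSet N Ω T) volume) :
    upperMinkContent N Ω r = 0 := by
  refine Tendsto.limsup_eq ?_
  rcases le_or_gt 0 ((N : ℝ) + r) with hq | hq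
  · refine tendsto_of_tendsto_of_tendsto_of_le_of_le' tendsto_const_nhds
      (tendsto_volume_tailSet_atTop hmeas hfin) (Eventually.of_forall fun _ => zero_le) ?_
    filter_upwards [eventually_ge_atTop 1] with t ht
    refine ENNReal.div_le_of_le_mul ?_
    refine le_mul_of_one_le_right' ?_
    rw [ENNReal.one_le_ofReal]
    exact Real.one_le_rpow ht hq
  · set ν := (volume.restrict (tailSet N Ω T)).withDensity
      fun x => ENNReal.ofReal (‖x‖ ^ (-r - (N : ℝ))) with hν
    have : IsFiniteMeasure ν := isFiniteMeasure_withDensity hint.lintegral_lt_top.ne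
    refine tendsto_of_tendsto_of_tendsto_of_le_of_le' tendsto_const_nhds
      (tendsto_measure_le_norm_atTop ν) (Eventually.of_forall fun _ => zero_le) ?_
    filter_upwards [eventually_ge_atTop T, eventually_gt_atTop 0] with t htT ht0
    have hset : MeasurableSet {x : EuclideanSpace ℝ (Fin N) | t ≤ ‖x‖} :=
      measurableSet_le measurable_const measurable_norm
    have hinter : {x : EuclideanSpace ℝ (Fin N) | t ≤ ‖x‖} ∩ tailSet N Ω T = tailSet N Ω t := by
      ext x
      exact ⟨fun hx => ⟨hx.2.1, hx.1⟩, fun hx => ⟨hx.2, hx.1, htT.trans hx.2⟩⟩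
    rw [hν, withDensity_apply _ hset, Measure.restrict_restrict hset, hinter, div_eq_mul_inv,
      ← ENNReal.ofReal_inv_of_pos (by positivity), ← Real.rpow_neg ht0.le, mul_comm,
      ← setLIntegral_const]
    refine setLIntegral_mono' (measurableSet_tailSet hmeas t) fun x hx => ?_
    refine ENNReal.ofReal_le_ofReal ?_
    rw [show -((N : ℝ) + r) = -r - N by ring]
    exact Real.rpow_le_rpow ht0.le hx.2 (by linarith)

/-- Two sets of reals that are upward approximations of each other have the same infimum. -/
lemma sInf_eq_sInf_of_subset_of_forall_lt_mem {A B : Set ℝ} (hA : A.Nonempty) (hAB : A ⊆ B)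
    (hBA : ∀ b ∈ B, ∀ a, b < a → a ∈ A) : sInf B = sInf A := by
  by_cases hbdd : BddBelow B
  · refine le_antisymm (csInf_le_csInf hbdd hA hAB) ?_
    refine le_csInf (hA.mono hAB) fun b hb => le_of_forall_gt_imp_ge_of_dense fun a ha => ?_
    exact csInf_le (hbdd.mono hAB) (hBA b hb a ha)
  · have hbddA : ¬ BddBelow A := fun ⟨m, hm⟩ => hbdd ⟨m - 1, fun b hb => by
      linarith [hm (hBA b hb (b + 1) (by linarith))]⟩
    rw [Real.sInf_of_not_bddBelow hbdd, Real.sInf_of_not_bddBelow hbddA]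

/-- The abscissa of convergence of the distance zeta function is the upper Minkowski dimension. -/
lemma distAbscissa_eq_upperMinkDim (hmeas : MeasurableSet Ω) (hfin : volume Ω < ⊤)
    {T : ℝ} (hT : 0 < T) : distAbscissa N Ω T = upperMinkDim N Ω := by
  refine sInf_eq_sInf_of_subset_of_forall_lt_mem ⟨-N, ?_⟩ ?_ ?_
  · exact upperMinkContent_eq_zero_of_integrableOn hmeas hfin
      (integrableOn_rpow_norm_of_nonpos hmeas hfin hT (by simp))
  · intro r hr s hs
    rw [integrableOn_cpow_norm_iff hmeas hT]
    exact integrableOn_rpow_norm_of_upperMinkContent_eq_zero hmeas hfin hT hr hs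
  · intro σ hσ r hr
    have hint := hσ (r : ℂ) (by simpa using hr)
    rw [integrableOn_cpow_norm_iff hmeas hT, ofReal_re] at hint
    exact upperMinkContent_eq_zero_of_integrableOn hmeas hfin hint

lemma integral_image_smul {E F : Type*} [NormedAddCommGroup E] [NormedSpace ℝ E]
    [MeasurableSpace E] [BorelSpace E] [FiniteDimensional ℝ E] [NormedAddCommGroup F]
    [NormedSpace ℝ F] (μ : Measure E) [μ.IsAddHaarMeasure] (f : E → F) (A : Set E) {l : ℝ}
    (hl : 0 < l) :
    ∫ x in (fun x => l • x) '' A, f x ∂μ =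
      l ^ Module.finrank ℝ E • ∫ x in A, f (l • x) ∂μ := by
  rw [Measure.setIntegral_comp_smul_of_pos μ f A hl, smul_inv_smul₀ (by positivity)]
  rfl

lemma cpow_norm_smul {E : Type*} [NormedAddCommGroup E] [NormedSpace ℝ E] {l : ℝ} (hl : 0 < l)
    (x : E) (z : ℂ) : ((‖l • x‖ : ℝ) : ℂ) ^ z = (l : ℂ) ^ z * (‖x‖ : ℂ) ^ z := by
  rw [norm_smul, Real.norm_of_nonneg hl.le, ofReal_mul,
    mul_cpow_ofReal_nonneg hl.le (norm_nonneg x)]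

/-- The distance zeta function of a dilated set. -/
lemma distZeta_image_smul {l : ℝ} (hl : 0 < l) (T : ℝ) (s : ℂ) :
    distZeta N ((fun x => l • x) '' Ω) (l * T) s = (l : ℂ) ^ (-s) * distZeta N Ω T s := by
  have hl0 : (l : ℂ) ≠ 0 := ofReal_ne_zero.2 hl.ne'
  unfold distZeta
  rw [tailSet_smul hl, integral_image_smul _ _ _ hl]
  simp_rw [cpow_norm_smul hl]
  rw [integral_const_mul, finrank_euclideanSpace_fin, real_smul, ← mul_assoc, cpow_sub _ _ hl0,
    cpow_natCast, ofReal_pow, mul_div_cancel₀ _ (pow_ne_zero _ hl0)]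

lemma integrableOn_cpow_norm_image_smul_iff {l : ℝ} (hl : 0 < l)
    (A : Set (EuclideanSpace ℝ (Fin N))) (hA : MeasurableSet A) (z : ℂ) :
    IntegrableOn (fun x => (‖x‖ : ℂ) ^ z) ((fun x => l • x) '' A) volume ↔
      IntegrableOn (fun x => (‖x‖ : ℂ) ^ z) A volume := by
  have hl0 : (l : ℂ) ≠ 0 := ofReal_ne_zero.2 hl.ne'
  have himg : MeasurableSet ((fun x => l • x) '' A) := hA.const_smul₀ l
  rw [← integrable_indicator_iff himg, ← integrable_indicator_iff hA,
    ← integrable_comp_smul_iff volume _ hl.ne']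
  have hcomp : (fun x => indicator ((fun x => l • x) '' A)
      (fun x => (‖x‖ : ℂ) ^ z) (l • x)) =
      fun x => (l : ℂ) ^ z * A.indicator (fun x => (‖x‖ : ℂ) ^ z) x := by
    ext x
    have hmem : l • x ∈ (fun x => l • x) '' A ↔ x ∈ A :=
      (smul_right_injective _ hl.ne').mem_set_image
    by_cases hx : x ∈ A
    · rw [indicator_of_mem (hmem.2 hx), indicator_of_mem hx, cpow_norm_smul hl]
    · rw [indicator_of_notMem (mt hmem.1 hx), indicator_of_notMem hx, mul_zero]
  rw [hcomp, integrable_const_mul_iff (by simp [cpow_eq_zero_iff, hl0])]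

lemma distAbscissa_image_smul (hmeas : MeasurableSet Ω) {l : ℝ} (hl : 0 < l) (T : ℝ) :
    distAbscissa N ((fun x => l • x) '' Ω) (l * T) = distAbscissa N Ω T := by
  unfold distAbscissa
  simp_rw [tailSet_smul hl,
    integrableOn_cpow_norm_image_smul_iff hl _ (measurableSet_tailSet hmeas T)]

end

/-- scaling property of the distance zeta function at infinity:
`D(ζ_{∞,λΩ}) = D(ζ_{∞,Ω}) = dim̄_B(∞,Ω)`, `ζ_{∞,λΩ}(s;λT) = λ^{-s} ζ_{∞,Ω}(s;T)` on the
half-plane of convergence, and the residues at a simple pole `ω` of a meromorphic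
continuation scale by `λ^{-ω}`. -/
theorem scaling_property_of_distance_zeta
    (N : ℕ) (Ω : Set (EuclideanSpace ℝ (Fin N)))
    (hmeas : MeasurableSet Ω) (hfin : volume Ω < ⊤)
    (T : ℝ) (hT : 0 < T) (l : ℝ) (hl : 0 < l) :
    distAbscissa N ((fun x => l • x) '' Ω) (l * T) = upperMinkDim N Ω ∧
    distAbscissa N Ω T = upperMinkDim N Ω ∧
    (∀ s : ℂ, upperMinkDim N Ω < s.re →
      distZeta N ((fun x => l • x) '' Ω) (l * T) s = ((l : ℂ) ^ (-s)) * distZeta N Ω T s) ∧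
    (∀ (U S : Set ℂ), IsOpen U → IsConnected U →
      {s : ℂ | s.re = upperMinkDim N Ω} ⊆ U → S ⊆ U →
      ∀ g : ℂ → ℂ, DifferentiableOn ℂ g (U \ S) →
      (∀ s ∈ U, upperMinkDim N Ω < s.re → g s = distZeta N Ω T s) →
      ∀ ω ∈ U, ∀ r : ℂ, r ≠ 0 →
      Tendsto (fun s : ℂ => (s - ω) * g s) (𝓝[≠] ω) (𝓝 r) →
      DifferentiableOn ℂ (fun s : ℂ => ((l : ℂ) ^ (-s)) * g s) (U \ S) ∧
      (∀ s ∈ U, upperMinkDim N Ω < s.re →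
        ((l : ℂ) ^ (-s)) * g s = distZeta N ((fun x => l • x) '' Ω) (l * T) s) ∧
      Tendsto (fun s : ℂ => (s - ω) * (((l : ℂ) ^ (-s)) * g s)) (𝓝[≠] ω)
        (𝓝 (((l : ℂ) ^ (-ω)) * r))) := by
  have hl0 : (l : ℂ) ≠ 0 := ofReal_ne_zero.2 hl.ne'
  have hdim := distAbscissa_eq_upperMinkDim hmeas hfin hT
  refine ⟨(distAbscissa_image_smul hmeas hl T).trans hdim, hdim,
    fun s _ => distZeta_image_smul hl T s, ?_⟩
  intro U S _ _ _ _ g hg hgz ω _ r _ hr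
  have hdiff : Differentiable ℂ fun s : ℂ => (l : ℂ) ^ (-s) := fun s =>
    differentiableAt_id.neg.const_cpow (Or.inl hl0)
  refine ⟨hdiff.differentiableOn.mul hg, fun s hsU hs => ?_, ?_⟩
  · rw [hgz s hsU hs, distZeta_image_smul hl T s]
  · refine (((hdiff ω).continuousAt.tendsto.mono_left nhdsWithin_le_nhds).mul hr).congr
      fun s => ?_
    ring
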